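/- arXiv:1612.05040 — 2 statements merged into one kernel-verified Lean document; each statement's English description precedes it below -/
import Mathlib

section
/- Let n ≥ 1 and let A ∈ ℝ≥0^{n×n} be a nonzero circulant matrix, and set B = A/λ(A) (entrywise division by λ(A), which is nonzero). Then there exists σ ≥ 1 such that B^{t+σ} = B^t for all t ≥ (n−1)² + 1; that is, the sequence of max-algebraic powers {B^t} is ultimately periodic with transient at most (n−1)² + 1. -/
open scoped NNReal Classical

namespace MaxAlg

variable {n : ℕ}

/-- cyclic successor on `Fin k` -/
def cyc {k : ℕ} (l : Fin k) : Fin k := ⟨(l.val + 1) % k, Nat.mod_lt _ l.pos⟩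

/-- max-algebraic matrix product -/
noncomputable def mmul (A B : Matrix (Fin n) (Fin n) ℝ≥0) : Matrix (Fin n) (Fin n) ℝ≥0 :=
  fun i k => Finset.univ.sup fun j => A i j * B j k

/-- max-algebraic identity matrix -/
def mId (n : ℕ) : Matrix (Fin n) (Fin n) ℝ≥0 := fun i j => if i = j then 1 else 0

/-- max-algebraic matrix power -/
noncomputable def mpow (A : Matrix (Fin n) (Fin n) ℝ≥0) : ℕ → Matrix (Fin n) (Fin n) ℝ≥0
  | 0 => mId n
  | t + 1 => mmul (mpow A t) A

/-- max-algebraic matrix-vector product -/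
noncomputable def mvec (A : Matrix (Fin n) (Fin n) ℝ≥0) (x : Fin n → ℝ≥0) : Fin n → ℝ≥0 :=
  fun i => Finset.univ.sup fun j => A i j * x j

/-- geometric mean of the cycle `c` of length `k` -/
noncomputable def cycMean (A : Matrix (Fin n) (Fin n) ℝ≥0) (k : ℕ) (c : Fin k → Fin n) : ℝ≥0 :=
  (∏ l : Fin k, A (c l) (c (cyc l))) ^ ((1 : ℝ) / (k : ℝ))

/-- maximum cycle geometric mean λ(A) -/
noncomputable def lam (A : Matrix (Fin n) (Fin n) ℝ≥0) : ℝ≥0 :=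
  (Finset.Icc 1 n).sup fun k => Finset.univ.sup fun c : Fin k → Fin n => cycMean A k c

/-- attraction cone Attr(A) -/
def Attr (A : Matrix (Fin n) (Fin n) ℝ≥0) : Set (Fin n → ℝ≥0) :=
  {x | ∃ s : ℕ, mvec (mpow A (s + 1)) x = fun i => lam A * mvec (mpow A s) x i}

/-- circulant matrix built from the vector of values `a_0, …, a_{n-1}` -/
def circ (a : Fin n → ℝ≥0) : Matrix (Fin n) (Fin n) ℝ≥0 := fun i j => a (j - i)

/-- A is a circulant matrix -/
def IsCirculant (A : Matrix (Fin n) (Fin n) ℝ≥0) : Prop := ∃ a : Fin n → ℝ≥0, A = circ a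

/-- (i,j) is a critical edge of A -/
def IsCritEdge (A : Matrix (Fin n) (Fin n) ℝ≥0) (i j : Fin n) : Prop :=
  A i j ≠ 0 ∧ ∃ (k : ℕ) (c : Fin k → Fin n), 1 ≤ k ∧
    (∀ l, A (c l) (c (cyc l)) ≠ 0) ∧
    cycMean A k c = lam A ∧ ∃ l, c l = i ∧ c (cyc l) = j

/-- there is a walk of length ≥ 1 from i to j in crit(A) -/
def CritWalk (A : Matrix (Fin n) (Fin n) ℝ≥0) (i j : Fin n) : Prop :=
  ∃ l : ℕ, 1 ≤ l ∧ ∃ w : ℕ → Fin n, w 0 = i ∧ w l = j ∧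
    ∀ r < l, IsCritEdge A (w r) (w (r + 1))

/-- node i lies on a critical cycle of A -/
def OnCritCycle (A : Matrix (Fin n) (Fin n) ℝ≥0) (i : Fin n) : Prop :=
  ∃ (k : ℕ) (c : Fin k → Fin n), 1 ≤ k ∧
    (∀ l, A (c l) (c (cyc l)) ≠ 0) ∧
    cycMean A k c = lam A ∧ ∃ l, c l = i

/-- family of one-dimensional intervals with bounds `lo`, `hi`,
each of one of the four forms -/
def IsIntervalFam (S : Fin n → Set ℝ≥0) (lo hi : Fin n → ℝ≥0) : Prop :=
  ∀ i, (S i).Nonempty ∧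
    (S i = Set.Icc (lo i) (hi i) ∨ S i = Set.Ico (lo i) (hi i) ∨
     S i = Set.Ioc (lo i) (hi i) ∨ S i = Set.Ioo (lo i) (hi i))

/-- the interval 𝐗 ⊆ ℝ≥0ⁿ determined by the family S -/
def box (S : Fin n → Set ℝ≥0) : Set (Fin n → ℝ≥0) := {x | ∀ i, x i ∈ S i}

/-- vertex x^{(k)}: x̄ in coordinate k and x̲ elsewhere -/
def vtx (lo hi : Fin n → ℝ≥0) (k : Fin n) : Fin n → ℝ≥0 :=
  Function.update lo k (hi k)

/-- the interval circulant matrix C(𝐚) determined by the interval family Sa -/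
def Cset (Sa : Fin n → Set ℝ≥0) : Set (Matrix (Fin n) (Fin n) ℝ≥0) :=
  {A | ∃ a : Fin n → ℝ≥0, (∀ k, a k ∈ Sa k) ∧ A = circ a}

/-- the matrix Â, with â_k = min(a̲, ā_k) where a̲ = max_k a̲_k -/
noncomputable def Ahat (alo ahi : Fin n → ℝ≥0) : Matrix (Fin n) (Fin n) ℝ≥0 :=
  circ fun k => min (Finset.univ.sup alo) (ahi k)

/-- the matrix A^{(k)} = Circulant(a̲_0,…,a̲_{k−1}, ā_k, a̲_{k+1},…,a̲_{n−1}) -/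
def Ak (alo ahi : Fin n → ℝ≥0) (k : Fin n) : Matrix (Fin n) (Fin n) ℝ≥0 :=
  circ (Function.update alo k (ahi k))

end MaxAlg
namespace MaxAlg

theorem mpow_succ_apply {n : ℕ} (C : Matrix (Fin n) (Fin n) ℝ≥0) (t : ℕ) (i k : Fin n) :
    mpow C (t + 1) i k = Finset.univ.sup fun j => mpow C t i j * C j k := rfl

theorem mul_le_mpow_succ {n : ℕ} (C : Matrix (Fin n) (Fin n) ℝ≥0) (t : ℕ) (i j k : Fin n) :
    mpow C t i j * C j k ≤ mpow C (t + 1) i k := by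
  rw [mpow_succ_apply]
  exact Finset.le_sup (f := fun j => mpow C t i j * C j k) (Finset.mem_univ j)

theorem exists_mpow_succ_eq {n : ℕ} (C : Matrix (Fin n) (Fin n) ℝ≥0) (t : ℕ) (i k : Fin n) :
    ∃ j, mpow C (t + 1) i k = mpow C t i j * C j k := by
  obtain ⟨j, -, hj⟩ := Finset.exists_mem_eq_sup Finset.univ ⟨i, Finset.mem_univ i⟩
    (fun j => mpow C t i j * C j k)
  exact ⟨j, hj⟩

theorem mpow_le_succ {n : ℕ} {C : Matrix (Fin n) (Fin n) ℝ≥0} (hd : ∀ i, C i i = 1)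
    (t : ℕ) (i k : Fin n) : mpow C t i k ≤ mpow C (t + 1) i k := by
  simpa [hd] using mul_le_mpow_succ C t i k k

theorem mpow_le_one {n : ℕ} {C : Matrix (Fin n) (Fin n) ℝ≥0} (hC : ∀ i j, C i j ≤ 1)
    (t : ℕ) (i k : Fin n) : mpow C t i k ≤ 1 := by
  induction t generalizing k with
  | zero =>
    simp only [mpow, mId]
    split_ifs <;> simp
  | succ t ih =>
    obtain ⟨j, hj⟩ := exists_mpow_succ_eq C t i k
    rw [hj]
    exact mul_le_one' (ih j) (hC j k)

/-- If an entry of the power sequence increases at step `t + 1`, then `t + 1` other entries of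
the same row are at least as large. -/
theorem exists_finset_of_mpow_lt {n : ℕ} {C : Matrix (Fin n) (Fin n) ℝ≥0}
    (hd : ∀ i, C i i = 1) (hC : ∀ i j, C i j ≤ 1) (i : Fin n) (t : ℕ) (s : Fin n)
    (h : mpow C t i s < mpow C (t + 1) i s) :
    ∃ T : Finset (Fin n), T.card = t + 1 ∧ s ∉ T ∧
      ∀ x ∈ T, mpow C (t + 1) i s ≤ mpow C t i x := by
  induction t generalizing s with
  | zero =>
    have hle := mpow_le_one hC (0 + 1) i s
    refine ⟨{i}, by simp, fun hs => ?_, fun x hx => ?_⟩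
    · rw [Finset.mem_singleton] at hs
      subst hs
      exact absurd (h.trans_le hle) (by simp [mpow, mId])
    · rw [Finset.mem_singleton] at hx
      subst hx
      simpa [mpow, mId] using hle
  | succ t ih =>
    obtain ⟨j, hj⟩ := exists_mpow_succ_eq C (t + 1) i s
    have hjs : mpow C (t + 1 + 1) i s ≤ mpow C (t + 1) i j :=
      hj ▸ mul_le_of_le_one_right' (hC j s)
    have hlt : mpow C t i j < mpow C (t + 1) i j := by
      by_contra! hle
      refine h.not_ge (hj ▸ ?_)
      exact (mul_le_mul_left hle _).trans (mul_le_mpow_succ C t i j s)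
    obtain ⟨T, hT, hjT, hx⟩ := ih j hlt
    have hall : ∀ x ∈ insert j T, mpow C (t + 1 + 1) i s ≤ mpow C (t + 1) i x := by
      intro x hxT
      rcases Finset.mem_insert.1 hxT with rfl | hxT
      · exact hjs
      · exact (hjs.trans (hx x hxT)).trans (mpow_le_succ hd t i x)
    exact ⟨insert j T, by rw [Finset.card_insert_of_notMem hjT, hT],
      fun hs => h.not_ge (hall s hs), hall⟩

theorem mpow_succ_eq_self {n : ℕ} {C : Matrix (Fin n) (Fin n) ℝ≥0}
    (hd : ∀ i, C i i = 1) (hC : ∀ i j, C i j ≤ 1) {t : ℕ} (ht : n - 1 ≤ t) :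
    mpow C (t + 1) = mpow C t := by
  funext i s
  refine le_antisymm ?_ (mpow_le_succ hd t i s)
  by_contra! h
  obtain ⟨T, hT, hs, -⟩ := exists_finset_of_mpow_lt hd hC i t s h
  have hcard := Finset.card_le_univ (insert s T)
  rw [Finset.card_insert_of_notMem hs, hT, Fintype.card_fin] at hcard
  omega

theorem mpow_add_eq_self {n : ℕ} {C : Matrix (Fin n) (Fin n) ℝ≥0}
    (hd : ∀ i, C i i = 1) (hC : ∀ i j, C i j ≤ 1) {t : ℕ} (ht : n - 1 ≤ t) (s : ℕ) :
    mpow C (t + s) = mpow C t := by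
  induction s with
  | zero => rfl
  | succ s ih => rw [← add_assoc, mpow_succ_eq_self hd hC (by omega), ih]

theorem mpow_circ_eq_shift {n : ℕ} [NeZero n] (b : Fin n → ℝ≥0) (p : Fin n) (t : ℕ)
    (i k : Fin n) :
    mpow (circ b) t i k = mpow (circ fun g => b (g + p)) t i (k - t • p) := by
  induction t generalizing k with
  | zero => simp [mpow]
  | succ t ih =>
    have hsup := Finset.sup_map Finset.univ (Equiv.subRight (t • p)).toEmbedding fun j =>
      mpow (circ fun g => b (g + p)) t i j * circ (fun g => b (g + p)) j (k - (t + 1) • p)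
    rw [Finset.map_univ_equiv] at hsup
    rw [mpow_succ_apply, mpow_succ_apply, hsup]
    refine Finset.sup_congr rfl fun j _ => ?_
    simp only [ih, circ, Function.comp_apply, Equiv.coe_toEmbedding, Equiv.subRight_apply]
    congr 2
    rw [succ_nsmul]
    abel

theorem cycMean_circ_le {n : ℕ} {a : Fin n → ℝ≥0} {m : ℝ≥0} (ha : ∀ g, a g ≤ m) {k : ℕ}
    (hk : k ≠ 0) (c : Fin k → Fin n) : cycMean (circ a) k c ≤ m := by
  have hprod : ∏ l : Fin k, circ a (c l) (c (cyc l)) ≤ m ^ k := by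
    simpa using Finset.prod_le_pow_card Finset.univ
      (fun l => circ a (c l) (c (cyc l))) m fun l _ => ha _
  calc cycMean (circ a) k c ≤ (m ^ k) ^ ((1 : ℝ) / k) :=
        NNReal.rpow_le_rpow hprod (by positivity)
    _ = m := by rw [one_div, NNReal.pow_rpow_inv_natCast m hk]

theorem cycMean_circ_nsmul {n : ℕ} [NeZero n] (a : Fin n → ℝ≥0) (p : Fin n) :
    cycMean (circ a) n (fun l => l.val • p) = a p := by
  have hn : n • p = 0 := by simpa using card_nsmul_eq_zero' (x := p)
  have hstep (l : Fin n) : (cyc l).val • p - l.val • p = p := by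
    have hmod : ((l.val + 1) % n) • p = (l.val + 1) • p := by
      conv_rhs => rw [← Nat.mod_add_div (l.val + 1) n, add_nsmul, mul_nsmul, hn, nsmul_zero,
        add_zero]
    rw [cyc, hmod, succ_nsmul, add_sub_cancel_left]
  simp only [cycMean, circ, hstep, Finset.prod_const, Finset.card_univ, Fintype.card_fin]
  rw [one_div, NNReal.pow_rpow_inv_natCast _ (NeZero.ne n)]

theorem lam_circ {n : ℕ} [NeZero n] {a : Fin n → ℝ≥0} {p : Fin n} (hp : ∀ g, a g ≤ a p) :
    lam (circ a) = a p := by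
  refine le_antisymm (Finset.sup_le fun k hk => Finset.sup_le fun c _ =>
    cycMean_circ_le hp (by have := (Finset.mem_Icc.1 hk).1; omega) c) ?_
  have hmem : n ∈ Finset.Icc 1 n := Finset.mem_Icc.2 ⟨NeZero.one_le, le_rfl⟩
  calc a p = cycMean (circ a) n (fun l => l.val • p) := (cycMean_circ_nsmul a p).symm
    _ ≤ Finset.univ.sup fun c : Fin n → Fin n => cycMean (circ a) n c :=
        Finset.le_sup (f := fun c => cycMean (circ a) n c) (Finset.mem_univ _)
    _ ≤ lam (circ a) :=
        Finset.le_sup (f := fun k => Finset.univ.sup fun c : Fin k → Fin n =>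
          cycMean (circ a) k c) hmem

/-- A circulant matrix with largest entry `1` has ultimately periodic powers, with period
dividing `n` and transient at most `n - 1`. -/
theorem mpow_circ_add_eq_self {n : ℕ} [NeZero n] {b : Fin n → ℝ≥0} {p : Fin n}
    (hp : b p = 1) (hb : ∀ g, b g ≤ 1) {t : ℕ} (ht : n - 1 ≤ t) :
    mpow (circ b) (t + n) = mpow (circ b) t := by
  have hn : n • p = 0 := by simpa using card_nsmul_eq_zero' (x := p)
  funext i k
  rw [mpow_circ_eq_shift b p, mpow_circ_eq_shift b p, add_nsmul, hn, add_zero,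
    mpow_add_eq_self (C := circ fun g => b (g + p)) (by simp [circ, hp]) (fun _ _ => hb _) ht]

end MaxAlg

open MaxAlg in
/-- for a nonzero circulant matrix `A`, the sequence of max-algebraic powers of
`B = A/λ(A)` is ultimately periodic with transient at most `(n-1)² + 1`. -/
theorem circulant_power_periodic
    (n : ℕ) (hn : 1 ≤ n) (A : Matrix (Fin n) (Fin n) ℝ≥0)
    (hA : IsCirculant A) (hA0 : A ≠ 0) :
    ∃ σ : ℕ, 1 ≤ σ ∧ ∀ t : ℕ, (n - 1) ^ 2 + 1 ≤ t →
      mpow (fun i j => A i j / lam A) (t + σ) = mpow (fun i j => A i j / lam A) t := by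
  have : NeZero n := ⟨by omega⟩
  obtain ⟨a, rfl⟩ := hA
  obtain ⟨p, hp⟩ := Finite.exists_max a
  have hap : a p ≠ 0 := by
    intro h
    refine hA0 (funext fun i => funext fun j => ?_)
    simpa [h, circ] using hp (j - i)
  refine ⟨n, hn, fun t ht => ?_⟩
  rw [lam_circ hp]
  refine mpow_circ_add_eq_self (b := fun g => a g / a p) (p := p) (div_self hap)
    (fun g => div_le_one_of_le₀ (hp g) zero_le) ?_
  exact (Nat.le_self_pow two_ne_zero _).trans ((Nat.le_succ _).trans ht)
end

section
/- Let n ≥ 1, let 𝐗 ⊆ ℝ≥0^n be an interval with bound vectors x̲, x̄, and let A ∈ ℝ≥0^{n×n} be a circulant matrix. Then 𝐗 ⊆ Attr(A) if and only if x^{(i)} ∈ Attr(A) for every i ∈ {1,…,n}. -/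
open scoped NNReal Classical

namespace MaxAlg

section Products

variable {n : ℕ}

theorem mvec_mmul (A B : Matrix (Fin n) (Fin n) ℝ≥0) (x : Fin n → ℝ≥0) :
    mvec (mmul A B) x = mvec A (mvec B x) := by
  funext i
  simp only [mvec, mmul, NNReal.finset_sup_mul, NNReal.mul_finset_sup]
  rw [Finset.sup_comm]
  simp only [mul_assoc]

theorem mvec_mId (x : Fin n → ℝ≥0) : mvec (mId n) x = x := by
  funext i
  refine le_antisymm (Finset.sup_le fun j _ => ?_) ?_
  · by_cases h : i = j <;> simp [mId, h]
  · refine le_trans ?_ (Finset.le_sup (f := fun j => mId n i j * x j) (Finset.mem_univ i))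
    simp [mId]

theorem mvec_mul_left (A : Matrix (Fin n) (Fin n) ℝ≥0) (c : ℝ≥0) (x : Fin n → ℝ≥0) :
    mvec A (fun j => c * x j) = fun i => c * mvec A x i := by
  funext i
  simp only [mvec, NNReal.mul_finset_sup, mul_left_comm]

theorem mvec_sup {ι : Type*} (A : Matrix (Fin n) (Fin n) ℝ≥0) (u : Finset ι)
    (v : ι → Fin n → ℝ≥0) :
    mvec A (fun j => u.sup fun k => v k j) = fun i => u.sup fun k => mvec A (v k) i := by
  funext i
  simp only [mvec, NNReal.mul_finset_sup]
  rw [Finset.sup_comm]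

theorem mvec_mpow (A : Matrix (Fin n) (Fin n) ℝ≥0) (s : ℕ) (x : Fin n → ℝ≥0) :
    mvec (mpow A s) x = (mvec A)^[s] x := by
  induction s generalizing x with
  | zero => simp [mpow, mvec_mId]
  | succ s ih => rw [mpow, mvec_mmul, ih, Function.iterate_succ_apply]

theorem continuous_mvec (A : Matrix (Fin n) (Fin n) ℝ≥0) : Continuous (mvec A) := by
  refine continuous_pi fun i => ?_
  unfold mvec
  exact Continuous.finset_sup_apply fun j _ => by fun_prop

/-- Once `A^{s+1} ⊗ x = λ(A) A^s ⊗ x` holds, it holds for all larger exponents. -/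
theorem mvec_mpow_succ_of_le {A : Matrix (Fin n) (Fin n) ℝ≥0} {x : Fin n → ℝ≥0} {s t : ℕ}
    (hst : s ≤ t) (h : mvec (mpow A (s + 1)) x = fun i => lam A * mvec (mpow A s) x i) :
    mvec (mpow A (t + 1)) x = fun i => lam A * mvec (mpow A t) x i := by
  induction t, hst using Nat.le_induction with
  | base => exact h
  | succ t _ ih =>
    have step (r : ℕ) : mvec (mpow A (r + 1)) x = mvec A (mvec (mpow A r) x) := by
      simp only [mvec_mpow, Function.iterate_succ_apply']
    rw [step (t + 1), ih, mvec_mul_left, ← step, ih]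

theorem sup_mul_mem_Attr {ι : Type*} (A : Matrix (Fin n) (Fin n) ℝ≥0) (u : Finset ι)
    (c : ι → ℝ≥0) (v : ι → Fin n → ℝ≥0) (hv : ∀ k, v k ∈ Attr A) :
    (fun j => u.sup fun k => c k * v k j) ∈ Attr A := by
  choose s hs using hv
  refine ⟨u.sup s, ?_⟩
  simp only [mvec_sup, mvec_mul_left, NNReal.mul_finset_sup]
  funext i
  refine Finset.sup_congr rfl fun k hk => ?_
  rw [mvec_mpow_succ_of_le (Finset.le_sup hk) (hs k), mul_left_comm]

end Products

section Circulant

variable {n : ℕ} [NeZero n] (a : Fin n → ℝ≥0)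

theorem card_nsmul_fin (t : Fin n) : n • t = 0 := by
  simpa using card_nsmul_eq_zero' (G := Fin n) (x := t)

theorem lam_circ_s19 : lam (circ a) = Finset.univ.sup a := by
  refine le_antisymm (Finset.sup_le fun k hk => Finset.sup_le fun c _ => ?_)
    (Finset.sup_le fun t _ => ?_)
  · have hk0 : (k : ℝ) ≠ 0 := by
      have := (Finset.mem_Icc.1 hk).1
      positivity
    have h : ∏ l : Fin k, circ a (c l) (c (cyc l)) ≤ (Finset.univ.sup a) ^ k := by
      simpa using Finset.prod_le_pow_card (Finset.univ : Finset (Fin k))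
        (fun l => circ a (c l) (c (cyc l))) (Finset.univ.sup a)
        fun l _ => Finset.le_sup (f := a) (Finset.mem_univ _)
    calc cycMean (circ a) k c ≤ ((Finset.univ.sup a) ^ k) ^ ((1 : ℝ) / k) :=
          NNReal.rpow_le_rpow h (by positivity)
      _ = Finset.univ.sup a := by
          rw [← NNReal.rpow_natCast, ← NNReal.rpow_mul, mul_one_div_cancel hk0, NNReal.rpow_one]
  · have hn0 : (n : ℝ) ≠ 0 := Nat.cast_ne_zero.2 (NeZero.ne n)
    have hedge (l : Fin n) : circ a (l.val • t) ((cyc l).val • t) = a t := by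
      have : (cyc l).val • t = (l.val + 1) • t := by
        conv_rhs => rw [← Nat.mod_add_div (l.val + 1) n, add_nsmul, mul_nsmul, card_nsmul_fin,
          nsmul_zero, add_zero]
        rfl
      rw [circ, this, succ_nsmul, add_sub_cancel_left]
    have hmean : cycMean (circ a) n (fun l => l.val • t) = a t := by
      simp only [cycMean, hedge, Finset.prod_const, Finset.card_univ, Fintype.card_fin]
      rw [← NNReal.rpow_natCast, ← NNReal.rpow_mul, mul_one_div_cancel hn0, NNReal.rpow_one]
    rw [← hmean]
    refine le_trans ?_ (Finset.le_sup (f := fun k => Finset.univ.sup fun c : Fin k → Fin n =>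
      cycMean (circ a) k c) (Finset.mem_Icc.2 ⟨NeZero.one_le, le_rfl⟩))
    exact Finset.le_sup (f := fun c => cycMean (circ a) n c) (Finset.mem_univ _)

theorem prod_le_mpow_circ (m : Multiset (Fin n)) (i j : Fin n) (hm : m.sum = j - i) :
    (m.map a).prod ≤ mpow (circ a) m.card i j := by
  induction m using Multiset.induction generalizing j with
  | empty =>
    have : i = j := (sub_eq_zero.1 (by simpa using hm.symm)).symm
    simp [mpow, mId, this]
  | cons t m ih =>
    rw [Multiset.map_cons, Multiset.prod_cons, Multiset.card_cons, mpow, mmul]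
    rw [Multiset.sum_cons] at hm
    refine le_trans ?_ (Finset.le_sup (f := fun k => mpow (circ a) m.card i k * circ a k j)
      (Finset.mem_univ (j - t)))
    have h : m.sum = j - t - i := by rw [sub_right_comm, ← hm, add_sub_cancel_left]
    rw [mul_comm]
    have ht : circ a (j - t) j = a t := by rw [circ, sub_sub_cancel]
    rw [ht]
    gcongr
    exact ih _ h

theorem exists_mpow_circ_le_prod (s : ℕ) (i j : Fin n) (h : mpow (circ a) s i j ≠ 0) :
    ∃ m : Multiset (Fin n), m.card = s ∧ m.sum = j - i ∧
      mpow (circ a) s i j ≤ (m.map a).prod := by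
  induction s generalizing j with
  | zero =>
    by_cases hij : i = j
    · exact ⟨0, by simp [hij, mpow, mId]⟩
    · simp [mpow, mId, hij] at h
  | succ s ih =>
    obtain ⟨k, -, hk⟩ := Finset.exists_mem_eq_sup Finset.univ Finset.univ_nonempty
      fun k => mpow (circ a) s i k * circ a k j
    have hk : mpow (circ a) (s + 1) i j = mpow (circ a) s i k * circ a k j := hk
    rw [hk] at h
    obtain ⟨m, hm, hsum, hle⟩ := ih k (left_ne_zero_of_mul h)
    refine ⟨(j - k) ::ₘ m, by simp [hm], by simp [hsum], ?_⟩
    rw [hk, Multiset.map_cons, Multiset.prod_cons, mul_comm]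
    exact mul_le_mul_right hle _

/-- Powers of a circulant matrix of order `n` are periodic up to scaling from exponent `n²` on. -/
theorem mpow_circ_add {s : ℕ} (hs : n * n ≤ s) (i j : Fin n) :
    mpow (circ a) (s + n) i j = lam (circ a) ^ n * mpow (circ a) s i j := by
  rw [lam_circ_s19]
  refine le_antisymm ?_ ?_
  · by_cases h : mpow (circ a) (s + n) i j = 0
    · simp [h]
    obtain ⟨m, hm, hsum, hle⟩ := exists_mpow_circ_le_prod a _ i j h
    obtain ⟨t, ht⟩ : ∃ t, n ≤ m.count t := by
      by_contra! hlt
      have : m.card ≤ n * n := by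
        rw [← Multiset.sum_count_eq_card (s := Finset.univ) (fun t _ => Finset.mem_univ t)]
        simpa using Finset.sum_le_card_nsmul Finset.univ (fun t => m.count t) n
          fun t _ => (hlt t).le
      have := NeZero.pos n
      omega
    obtain ⟨m', rfl⟩ := Multiset.le_iff_exists_add.1 (Multiset.le_count_iff_replicate_le.1 ht)
    simp only [Multiset.card_add, Multiset.card_replicate] at hm
    obtain rfl : m'.card = s := by omega
    rw [Multiset.sum_add, Multiset.sum_replicate, card_nsmul_fin, zero_add] at hsum
    refine hle.trans ?_
    rw [Multiset.map_add, Multiset.prod_add, Multiset.map_replicate, Multiset.prod_replicate]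
    gcongr
    · exact Finset.le_sup (f := a) (Finset.mem_univ t)
    · exact prod_le_mpow_circ a m' i j hsum
  · by_cases h : mpow (circ a) s i j = 0
    · simp [h]
    obtain ⟨m, rfl, hsum, hle⟩ := exists_mpow_circ_le_prod a _ i j h
    obtain ⟨t, -, ht⟩ := Finset.exists_mem_eq_sup Finset.univ Finset.univ_nonempty a
    have := prod_le_mpow_circ a (m + Multiset.replicate n t) i j (by
      rw [Multiset.sum_add, Multiset.sum_replicate, card_nsmul_fin, add_zero, hsum])
    rw [Multiset.map_add, Multiset.prod_add, Multiset.map_replicate, Multiset.prod_replicate,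
      Multiset.card_add, Multiset.card_replicate, mul_comm] at this
    rw [ht]
    exact le_trans (mul_le_mul_right hle _) this

theorem mvec_mpow_circ_add_mul {s : ℕ} (hs : n * n ≤ s) (k : ℕ) (x : Fin n → ℝ≥0) :
    mvec (mpow (circ a) (s + n * k)) x =
      fun i => lam (circ a) ^ (n * k) * mvec (mpow (circ a) s) x i := by
  induction k with
  | zero => simp
  | succ k ih =>
    funext i
    have h : mvec (mpow (circ a) (s + n * k + n)) x i =
        lam (circ a) ^ n * mvec (mpow (circ a) (s + n * k)) x i := by
      simp only [mvec, NNReal.mul_finset_sup]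
      refine Finset.sup_congr rfl fun j _ => ?_
      rw [mpow_circ_add a (le_add_right hs), mul_assoc]
    rw [mul_add_one, ← add_assoc, h, ih, ← mul_assoc, ← pow_add, add_comm n]

theorem mem_Attr_circ_iff (x : Fin n → ℝ≥0) :
    x ∈ Attr (circ a) ↔ mvec (mpow (circ a) (n * n + n + 1)) x =
      fun i => lam (circ a) * mvec (mpow (circ a) (n * n + n)) x i := by
  refine ⟨fun ⟨s, hs⟩ => ?_, fun h => ⟨_, h⟩⟩
  have hn := NeZero.pos n
  by_cases h0 : lam (circ a) = 0
  · have h := mvec_mpow_circ_add_mul a (s := n * n + 1) (by omega) 1 x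
    rw [h0, mul_one, add_right_comm] at h
    rw [h, h0]
    simp [hn.ne']
  · have hle : s ≤ n * n + n + n * s := by nlinarith
    have h := mvec_mpow_succ_of_le hle hs
    rw [add_right_comm, mvec_mpow_circ_add_mul a (by omega),
      mvec_mpow_circ_add_mul a (by omega)] at h
    funext i
    have hi := congrFun h i
    rw [mul_left_comm] at hi
    exact mul_left_cancel₀ (pow_ne_zero _ h0) hi

theorem isClosed_Attr_circ : IsClosed (Attr (circ a)) := by
  have : Attr (circ a) = {x | mvec (mpow (circ a) (n * n + n + 1)) x =
      fun i => lam (circ a) * mvec (mpow (circ a) (n * n + n)) x i} :=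
    Set.ext fun x => mem_Attr_circ_iff a x
  rw [this]
  have hc := continuous_mvec (mpow (circ a) (n * n + n))
  exact isClosed_eq (continuous_mvec _) (by fun_prop)

end Circulant

section Interval

variable {n : ℕ} {S : Fin n → Set ℝ≥0} {lo hi : Fin n → ℝ≥0}

theorem IsIntervalFam.subset_Icc (hS : IsIntervalFam S lo hi) (i : Fin n) :
    S i ⊆ Set.Icc (lo i) (hi i) := by
  rcases (hS i).2 with h | h | h | h <;> rw [h]
  exacts [Set.Ico_subset_Icc_self, Set.Ioc_subset_Icc_self, Set.Ioo_subset_Icc_self]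

theorem IsIntervalFam.closure_eq (hS : IsIntervalFam S lo hi) (i : Fin n) :
    closure (S i) = Set.Icc (lo i) (hi i) := by
  obtain ⟨hne, h⟩ := hS i
  rcases h with h | h | h | h <;> rw [h] at hne ⊢
  · exact isClosed_Icc.closure_eq
  · exact closure_Ico (Set.nonempty_Ico.1 hne).ne
  · exact closure_Ioc (Set.nonempty_Ioc.1 hne).ne
  · exact closure_Ioo (Set.nonempty_Ioo.1 hne).ne

theorem IsIntervalFam.vtx_mem_closure_box (hS : IsIntervalFam S lo hi) (k : Fin n) :
    vtx lo hi k ∈ closure (box S) := by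
  have hbox : box S = Set.univ.pi S := by ext x; simp [box]
  rw [hbox, closure_pi_set]
  intro i _
  obtain ⟨y, hy⟩ := (hS i).1
  have hle := (hS.subset_Icc i hy).1.trans (hS.subset_Icc i hy).2
  change vtx lo hi k i ∈ closure (S i)
  rw [hS.closure_eq]
  by_cases hik : i = k
  · subst hik; simpa [vtx] using hle
  · simpa [vtx, hik] using hle

/-- Every point between the bounds is a max-algebraic combination of the vertices. -/
theorem eq_sup_mul_vtx {x : Fin n → ℝ≥0} (hx : ∀ i, x i ∈ Set.Icc (lo i) (hi i)) :
    x = fun j => Finset.univ.sup fun k => x k / hi k * vtx lo hi k j := by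
  have hdiag (j : Fin n) : x j / hi j * vtx lo hi j j = x j := by
    rw [vtx, Function.update_self]
    exact div_mul_cancel_of_imp fun h => le_antisymm (h ▸ (hx j).2) (zero_le)
  funext j
  refine le_antisymm ?_ (Finset.sup_le fun k _ => ?_)
  · refine (hdiag j).ge.trans ?_
    exact Finset.le_sup (f := fun k => x k / hi k * vtx lo hi k j) (Finset.mem_univ j)
  · by_cases hjk : j = k
    · subst hjk; exact (hdiag j).le
    · rw [vtx, Function.update_of_ne hjk]
      exact (mul_le_of_le_one_left' (div_le_one_of_le₀ (hx k).2 (zero_le))).trans (hx j).1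

end Interval

end MaxAlg

open MaxAlg in
/-- for an interval `𝐗` with bounds `x̲, x̄` and a circulant matrix `A`,
`𝐗 ⊆ Attr(A)` iff `x⁽ⁱ⁾ ∈ Attr(A)` for every `i`. -/
theorem box_subset_attr_iff
    (n : ℕ) (hn : 1 ≤ n)
    (S : Fin n → Set ℝ≥0) (lo hi : Fin n → ℝ≥0) (hS : IsIntervalFam S lo hi)
    (A : Matrix (Fin n) (Fin n) ℝ≥0) (hA : IsCirculant A) :
    box S ⊆ Attr A ↔ ∀ i : Fin n, vtx lo hi i ∈ Attr A := by
  have : NeZero n := ⟨Nat.one_le_iff_ne_zero.1 hn⟩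
  obtain ⟨a, rfl⟩ := hA
  refine ⟨fun h i => closure_minimal h (isClosed_Attr_circ a) (hS.vtx_mem_closure_box i),
    fun h x hx => ?_⟩
  rw [eq_sup_mul_vtx fun i => hS.subset_Icc i (hx i)]
  exact sup_mul_mem_Attr _ _ _ _ h
end
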